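/- For every integer n ≥ 2, the word (a b^{n−1})^{n−2} a, of length n(n−2) + 1 = (n−1)², is a reset word for the Černý automaton 𝒞_n. -/

import Mathlib

/-- The two input letters of the automaton. -/
inductive Letter | a | b

/-- Transition function of the Černý automaton `𝒞ₙ` on states `{1, …, n}`:
`δ(i,a) = i` for `i < n`, `δ(n,a) = 1`, `δ(i,b) = i+1` for `i < n`, `δ(n,b) = 1`. -/
def delta (n : ℕ) (q : ℕ) : Letter → ℕ
  | Letter.a => if q < n then q else 1
  | Letter.b => if q < n then q + 1 else 1

/-- `w` is a reset word: it sends every state in `{1, …, n}` to one single state. -/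
def IsReset (n : ℕ) (w : List Letter) : Prop :=
  ∃ p : ℕ, ∀ q ∈ Finset.Icc 1 n, w.foldl (delta n) q = p

/-- The word `(a b^{n-1})^{n-2} a`. -/
def theWord (n : ℕ) : List Letter :=
  (List.replicate (n - 2) (Letter.a :: List.replicate (n - 1) Letter.b)).flatten ++ [Letter.a]

theorem foldl_delta_replicate_b {n k q : ℕ} (hk : k ≤ n) (hq : q ≤ n) :
    (List.replicate k Letter.b).foldl (delta n) q = if q + k ≤ n then q + k else q + k - n := by
  induction k with
  | zero => simp [hq]
  | succ k ih =>
    rw [List.replicate_succ', List.foldl_append, ih (by omega)]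
    simp only [List.foldl_cons, List.foldl_nil, delta]
    split_ifs <;> omega

theorem foldl_delta_block {n q : ℕ} (h1 : 1 ≤ q) (hq : q ≤ n) :
    (Letter.a :: List.replicate (n - 1) Letter.b).foldl (delta n) q =
      if 1 < q ∧ q < n then q - 1 else n := by
  have hd : delta n q Letter.a ≤ n := by
    simp only [delta]; split_ifs <;> omega
  rw [List.foldl_cons, foldl_delta_replicate_b (by omega) hd]
  simp only [delta]
  split_ifs <;> omega

theorem foldl_delta_block_iterate {n q : ℕ} (k : ℕ) (h1 : 1 ≤ q) (hq : q ≤ n) :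
    (List.replicate k (Letter.a :: List.replicate (n - 1) Letter.b)).flatten.foldl (delta n) q =
      if k < q ∧ q < n then q - k else n := by
  induction k with
  | zero => simp only [List.replicate_zero, List.flatten_nil, List.foldl_nil]; split_ifs <;> omega
  | succ k ih =>
    rw [List.replicate_succ', List.flatten_append, List.foldl_append, ih, List.flatten_singleton,
      foldl_delta_block (by split_ifs <;> omega) (by split_ifs <;> omega)]
    split_ifs <;> omega

/-- The word `(a b^{n-1})^{n-2} a`, of length `n(n-2) + 1 = (n-1)²`, is a reset word
for the Černý automaton `𝒞ₙ`. -/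
theorem cerny_automaton_reset_word (n : ℕ) (hn : 2 ≤ n) :
    (theWord n).length = (n - 1) ^ 2 ∧ IsReset n (theWord n) := by
  refine ⟨?_, 1, fun q hq => ?_⟩
  · obtain ⟨m, rfl⟩ := Nat.exists_eq_add_of_le' hn
    simp [theWord]
    ring
  · rw [Finset.mem_Icc] at hq
    rw [theWord, List.foldl_append, foldl_delta_block_iterate _ hq.1 hq.2]
    simp only [List.foldl_cons, List.foldl_nil, delta]
    split_ifs <;> omega
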